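/- If φ_L and φ_R are Δ0 formulas over nested relations such that their conjunction entails ψ, then there exists a Δ0 formula θ whose free variables are among the common free variables of φ_L on one hand and φ_R together with ψ on the other, such that φ_L entails θ and θ together with φ_R entails ψ. -/

import Mathlib

inductive NTy : Type
  | ur : NTy
  | unit : NTy
  | prod : NTy → NTy → NTy
  | set : NTy → NTy
deriving DecidableEq

def NObj (U : Type) : NTy → Type
  | .ur => U
  | .unit => Unit
  | .prod a b => NObj U a × NObj U b
  | .set a => Set (NObj U a)

def NObj.asSet {U : Type} {T : NTy} (s : NObj U (NTy.set T)) : Set (NObj U T) := s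

def Env (U : Type) (Γ : List NTy) : Type := (i : Fin Γ.length) → NObj U (Γ.get i)

def Env.nil {U : Type} : Env U [] := fun i => i.elim0

def Env.cons {U : Type} {T : NTy} {Γ : List NTy} (x : NObj U T) (ρ : Env U Γ) :
    Env U (T :: Γ) := fun i =>
  Fin.cases (motive := fun i => NObj U ((T :: Γ).get i)) x (fun j => ρ j) i

inductive Tm : List NTy → NTy → Type
  | var {Γ} (i : Fin Γ.length) : Tm Γ (Γ.get i)
  | unit {Γ} : Tm Γ NTy.unit
  | pair {Γ a b} : Tm Γ a → Tm Γ b → Tm Γ (NTy.prod a b)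
  | fst {Γ a b} : Tm Γ (NTy.prod a b) → Tm Γ a
  | snd {Γ a b} : Tm Γ (NTy.prod a b) → Tm Γ b

def Tm.eval {U : Type} : ∀ {Γ T}, Tm Γ T → Env U Γ → NObj U T
  | _, _, .var i, ρ => ρ i
  | _, _, .unit, _ => ()
  | _, _, .pair s t, ρ => (s.eval ρ, t.eval ρ)
  | _, _, .fst t, ρ => (t.eval ρ).1
  | _, _, .snd t, ρ => (t.eval ρ).2

inductive D0 : List NTy → Type
  | eq {Γ} : Tm Γ NTy.ur → Tm Γ NTy.ur → D0 Γ
  | ne {Γ} : Tm Γ NTy.ur → Tm Γ NTy.ur → D0 Γ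
  | tru {Γ} : D0 Γ
  | fls {Γ} : D0 Γ
  | and {Γ} : D0 Γ → D0 Γ → D0 Γ
  | or {Γ} : D0 Γ → D0 Γ → D0 Γ
  | all {Γ T} : Tm Γ (NTy.set T) → D0 (T :: Γ) → D0 Γ
  | ex {Γ T} : Tm Γ (NTy.set T) → D0 (T :: Γ) → D0 Γ

def D0.Sat {U : Type} : ∀ {Γ}, D0 Γ → Env U Γ → Prop
  | _, .eq s t, ρ => s.eval ρ = t.eval ρ
  | _, .ne s t, ρ => s.eval ρ ≠ t.eval ρ
  | _, .tru, _ => True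
  | _, .fls, _ => False
  | _, .and φ ψ, ρ => φ.Sat ρ ∧ ψ.Sat ρ
  | _, .or φ ψ, ρ => φ.Sat ρ ∨ ψ.Sat ρ
  | _, .all t φ, ρ => ∀ x ∈ NObj.asSet (t.eval ρ), φ.Sat (Env.cons x ρ)
  | _, .ex t φ, ρ => ∃ x ∈ NObj.asSet (t.eval ρ), φ.Sat (Env.cons x ρ)

def Tm.fv : ∀ {Γ T}, Tm Γ T → Finset (Fin Γ.length)
  | _, _, .var i => {i}
  | _, _, .unit => ∅
  | _, _, .pair s t => s.fv ∪ t.fv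
  | _, _, .fst t => t.fv
  | _, _, .snd t => t.fv

def lowerFv {n : ℕ} (s : Finset (Fin (n + 1))) : Finset (Fin n) :=
  Finset.univ.filter (fun j => j.succ ∈ s)

def D0.fv : ∀ {Γ}, D0 Γ → Finset (Fin Γ.length)
  | _, .eq s t => s.fv ∪ t.fv
  | _, .ne s t => s.fv ∪ t.fv
  | _, .tru => ∅
  | _, .fls => ∅
  | _, .and φ ψ => φ.fv ∪ ψ.fv
  | _, .or φ ψ => φ.fv ∪ ψ.fv
  | _, .all t φ => t.fv ∪ lowerFv φ.fv
  | _, .ex t φ => t.fv ∪ lowerFv φ.fv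


/-! ### Basic facts about Δ₀ formulas -/

/-- Negation of a Δ₀ formula. -/
def D0.neg : ∀ {Γ}, D0 Γ → D0 Γ
  | _, .eq s t => .ne s t
  | _, .ne s t => .eq s t
  | _, .tru => .fls
  | _, .fls => .tru
  | _, .and φ ψ => .or φ.neg ψ.neg
  | _, .or φ ψ => .and φ.neg ψ.neg
  | _, .all t φ => .ex t φ.neg
  | _, .ex t φ => .all t φ.neg

theorem D0.neg_fv {Γ} (φ : D0 Γ) : φ.neg.fv = φ.fv := by
  induction φ <;> simp_all [D0.neg, D0.fv]

theorem D0.neg_sat {U : Type} {Γ} (φ : D0 Γ) (ρ : Env U Γ) : φ.neg.Sat ρ ↔ ¬ φ.Sat ρ := by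
  induction φ with
  | and φ ψ h1 h2 => simp only [D0.neg, D0.Sat, h1, h2]; tauto
  | or φ ψ h1 h2 => simp only [D0.neg, D0.Sat, h1, h2]; tauto
  | _ => simp_all [D0.neg, D0.Sat]

theorem Tm.eval_congr {U : Type} {Γ T} (t : Tm Γ T) (ρ ρ' : Env U Γ)
    (h : ∀ i ∈ t.fv, ρ i = ρ' i) : t.eval ρ = t.eval ρ' := by
  induction t with
  | var i => simp only [Tm.eval]; exact h i (by simp [Tm.fv])
  | unit => rfl
  | pair s t h1 h2 =>
    simp only [Tm.eval]
    rw [h1 fun i hi => h i (by simp [Tm.fv, hi]), h2 fun i hi => h i (by simp [Tm.fv, hi])]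
  | fst t ih => simp only [Tm.eval]; rw [ih (by simpa only [Tm.fv] using h)]
  | snd t ih => simp only [Tm.eval]; rw [ih (by simpa only [Tm.fv] using h)]

theorem mem_lowerFv {n : ℕ} (s : Finset (Fin (n + 1))) (j : Fin n) :
    j ∈ lowerFv s ↔ j.succ ∈ s := by
  simp [lowerFv]

theorem D0.sat_congr {U : Type} {Γ} (φ : D0 Γ) : ∀ (ρ ρ' : Env U Γ)
    (_ : ∀ i ∈ φ.fv, ρ i = ρ' i), φ.Sat ρ ↔ φ.Sat ρ' := by
  induction φ with
  | eq s t | ne s t =>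
    intro ρ ρ' h
    simp only [D0.Sat]
    rw [s.eval_congr ρ ρ' fun i hi => h i (by simp [D0.fv, hi]),
      t.eval_congr ρ ρ' fun i hi => h i (by simp [D0.fv, hi])]
  | tru | fls => intros; rfl
  | and φ ψ h1 h2 | or φ ψ h1 h2 =>
    intro ρ ρ' h
    simp only [D0.Sat]
    rw [h1 ρ ρ' fun i hi => h i (by simp [D0.fv, hi]),
      h2 ρ ρ' fun i hi => h i (by simp [D0.fv, hi])]
  | all t φ ih | ex t φ ih =>
    intro ρ ρ' h
    simp only [D0.Sat]
    rw [t.eval_congr ρ ρ' fun i hi => h i (by simp [D0.fv, hi])]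
    have key : ∀ x, φ.Sat (Env.cons x ρ) ↔ φ.Sat (Env.cons x ρ') := by
      intro x
      apply ih
      intro i
      refine Fin.cases ?_ (fun j => ?_) i
      · intro _; rfl
      · intro hj
        exact h j (by simp only [D0.fv, Finset.mem_union]; right; exact (mem_lowerFv _ _).2 hj)
    simp only [key]

/-! ### Change of the Ur-element domain -/

def NObj.map {U V : Type} (f : U → V) : ∀ T, NObj U T → NObj V T
  | .ur => f
  | .unit => fun _ => ()
  | .prod a b => fun x => (NObj.map f a x.1, NObj.map f b x.2)
  | .set a => fun s => (Set.image (NObj.map f a) s : Set (NObj V a))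

def Env.map {U V : Type} (f : U → V) {Γ} (ρ : Env U Γ) : Env V Γ := fun i => NObj.map f _ (ρ i)

theorem Env.map_cons {U V : Type} (f : U → V) {Γ T} (x : NObj U T) (ρ : Env U Γ) :
    Env.map f (Env.cons x ρ) = Env.cons (NObj.map f T x) (Env.map f ρ) := by
  funext i
  refine Fin.cases ?_ (fun j => ?_) i <;> rfl

theorem Tm.eval_map {U V : Type} (f : U → V) {Γ T} (t : Tm Γ T) (ρ : Env U Γ) :
    t.eval (Env.map f ρ) = NObj.map f T (t.eval ρ) := by
  induction t with
  | var i => simp only [Tm.eval]; rfl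
  | unit => simp only [Tm.eval]; rfl
  | pair s t h1 h2 => simp only [Tm.eval, h1, h2]; rfl
  | fst t ih => simp only [Tm.eval, ih]; rfl
  | snd t ih => simp only [Tm.eval, ih]; rfl

theorem D0.sat_map {U V : Type} (f : U → V) (hf : Function.Injective f) {Γ} (φ : D0 Γ) :
    ∀ (ρ : Env U Γ), φ.Sat (Env.map f ρ) ↔ φ.Sat ρ := by
  induction φ with
  | eq s t =>
    intro ρ
    simp only [D0.Sat, Tm.eval_map]
    exact hf.eq_iff
  | ne s t =>
    intro ρ
    simp only [D0.Sat, Tm.eval_map]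
    exact hf.ne_iff
  | tru | fls => intros; rfl
  | and φ ψ h1 h2 | or φ ψ h1 h2 => intro ρ; simp only [D0.Sat, h1, h2]
  | all t φ ih =>
    intro ρ
    simp only [D0.Sat, Tm.eval_map]
    constructor
    · intro h x hx
      rw [← ih, Env.map_cons]
      exact h _ ⟨x, hx, rfl⟩
    · rintro h _ ⟨x, hx, rfl⟩
      rw [← Env.map_cons, ih]
      exact h x hx
  | ex t φ ih =>
    intro ρ
    simp only [D0.Sat, Tm.eval_map]
    constructor
    · rintro ⟨_, ⟨x, hx, rfl⟩, h⟩
      rw [← Env.map_cons, ih] at h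
      exact ⟨x, hx, h⟩
    · rintro ⟨x, hx, h⟩
      refine ⟨_, ⟨x, hx, rfl⟩, ?_⟩
      rw [← Env.map_cons, ih]
      exact h

/-! ### Named variables, neutral terms, symbolic objects -/

/-- Neutral terms: iterated projections of named variables. -/
inductive Neu : NTy → Type
  | var (n : ℕ) (T : NTy) : Neu T
  | fst {a b} : Neu (NTy.prod a b) → Neu a
  | snd {a b} : Neu (NTy.prod a b) → Neu b

def Neu.base : ∀ {T}, Neu T → ℕ × NTy
  | _, .var n T => (n, T)
  | _, .fst t => t.base
  | _, .snd t => t.base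

abbrev Val (U : Type) : Type := ∀ (_ : ℕ) (T : NTy), NObj U T

def Neu.eval {U : Type} (v : Val U) : ∀ {T}, Neu T → NObj U T
  | _, .var n T => v n T
  | _, .fst t => (t.eval v).1
  | _, .snd t => (t.eval v).2

/-- Symbolic objects: eta-long normal forms. -/
def PObj : NTy → Type
  | .ur => Neu .ur
  | .unit => Unit
  | .prod a b => PObj a × PObj b
  | .set a => Neu (.set a)

def PObj.toNe {T : NTy} (c : PObj (NTy.set T)) : Neu (NTy.set T) := c
def PObj.toUr (c : PObj NTy.ur) : Neu NTy.ur := c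

def PObj.In (K : Set (ℕ × NTy)) : ∀ {T}, PObj T → Prop
  | .ur, c => Neu.base c.toUr ∈ K
  | .unit, _ => True
  | .prod a b, c => PObj.In K (T := a) c.1 ∧ PObj.In K (T := b) c.2
  | .set _, c => Neu.base c.toNe ∈ K

def PObj.eval {U : Type} (v : Val U) : ∀ {T}, PObj T → NObj U T
  | .ur, c => Neu.eval v c.toUr
  | .unit, _ => ()
  | .prod a b, c => (PObj.eval v (T := a) c.1, PObj.eval v (T := b) c.2)
  | .set _, c => Neu.eval v c.toNe

def reflect : ∀ T, Neu T → PObj T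
  | .ur => fun c => c
  | .unit => fun _ => ()
  | .prod a b => fun c => (reflect a c.fst, reflect b c.snd)
  | .set a => fun c => c

theorem reflect_eval {U : Type} (v : Val U) : ∀ T (c : Neu T), (reflect T c).eval v = c.eval v
  | .ur, _ => rfl
  | .unit, _ => rfl
  | .prod a b, c => by
    simp only [reflect, PObj.eval, reflect_eval v a, reflect_eval v b, Neu.eval]
    rfl
  | .set _, _ => rfl

theorem reflect_in (K) : ∀ T (c : Neu T), c.base ∈ K → (reflect T c).In K
  | .ur, _, h => h
  | .unit, _, _ => trivial
  | .prod a b, c, h => ⟨reflect_in K a c.fst h, reflect_in K b c.snd h⟩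
  | .set _, _, h => h

theorem Neu.eval_congr {U : Type} {K : Set (ℕ × NTy)} (v w : Val U)
    (h : ∀ n T, (n, T) ∈ K → v n T = w n T) {T} (c : Neu T) (hc : c.base ∈ K) :
    c.eval v = c.eval w := by
  induction c with
  | var n T => exact h _ _ hc
  | fst t ih => simp only [Neu.eval]; rw [ih hc]
  | snd t ih => simp only [Neu.eval]; rw [ih hc]

theorem PObj.eval_congr {U : Type} {K : Set (ℕ × NTy)} (v w : Val U)
    (h : ∀ n T, (n, T) ∈ K → v n T = w n T) : ∀ T (c : PObj T), c.In K → c.eval v = c.eval w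
  | .ur, c, hc => Neu.eval_congr (K := K) v w h c hc
  | .unit, _, _ => rfl
  | .prod a b, c, hc => by
    simp only [PObj.eval]
    rw [PObj.eval_congr v w h a c.1 hc.1, PObj.eval_congr v w h b c.2 hc.2]
  | .set _, c, hc => Neu.eval_congr (K := K) v w h c.toNe hc

theorem PObj.in_mono {K K' : Set (ℕ × NTy)} (h : K ⊆ K') : ∀ T (c : PObj T), c.In K → c.In K'
  | .ur, _, hc => h hc
  | .unit, _, _ => trivial
  | .prod a b, c, hc => ⟨PObj.in_mono h a c.1 hc.1, PObj.in_mono h b c.2 hc.2⟩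
  | .set _, _, hc => h hc

def PEnv (Γ : List NTy) : Type := (i : Fin Γ.length) → PObj (Γ.get i)

def PEnv.cons {T : NTy} {Γ : List NTy} (x : PObj T) (ρ : PEnv Γ) : PEnv (T :: Γ) := fun i =>
  Fin.cases (motive := fun i => PObj ((T :: Γ).get i)) x (fun j => ρ j) i

def Tm.peval {Γ} (ρ : PEnv Γ) : ∀ {T}, Tm Γ T → PObj T
  | _, .var i => ρ i
  | _, .unit => ()
  | _, .pair s t => (s.peval ρ, t.peval ρ)
  | _, .fst t => (t.peval ρ).1
  | _, .snd t => (t.peval ρ).2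

theorem Tm.peval_in {K} {Γ T} (t : Tm Γ T) (σ : PEnv Γ) (h : ∀ i ∈ t.fv, (σ i).In K) :
    (t.peval σ).In K := by
  induction t with
  | var i => exact h i (by simp [Tm.fv])
  | unit => trivial
  | pair s t h1 h2 =>
    exact ⟨h1 fun i hi => h i (by simp [Tm.fv, hi]), h2 fun i hi => h i (by simp [Tm.fv, hi])⟩
  | fst t ih => exact (ih (by simpa only [Tm.fv] using h)).1
  | snd t ih => exact (ih (by simpa only [Tm.fv] using h)).2

def PEnv.eval {U : Type} (v : Val U) {Γ} (σ : PEnv Γ) : Env U Γ := fun i => (σ i).eval v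

theorem PEnv.eval_cons {U : Type} (v : Val U) {Γ T} (c : PObj T) (σ : PEnv Γ) :
    (PEnv.cons c σ).eval v = Env.cons (c.eval v) (σ.eval v) := by
  funext i
  refine Fin.cases ?_ (fun j => ?_) i <;> rfl

theorem Tm.peval_eval {U : Type} (v : Val U) {Γ T} (t : Tm Γ T) (σ : PEnv Γ) :
    (t.peval σ).eval v = t.eval (σ.eval v) := by
  induction t with
  | var i => simp only [Tm.eval]; rfl
  | unit => simp only [Tm.eval]; rfl
  | pair s t h1 h2 => simp only [Tm.peval, Tm.eval, ← h1, ← h2]; rfl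
  | fst t ih => simp only [Tm.peval, Tm.eval, ← ih]; rfl
  | snd t ih => simp only [Tm.peval, Tm.eval, ← ih]; rfl

def Val.upd {U : Type} (v : Val U) (n : ℕ) (T : NTy) (y : NObj U T) : Val U := fun m T' =>
  if h : m = n ∧ T = T' then h.2 ▸ y else v m T'

theorem Val.upd_same {U : Type} (v : Val U) (n : ℕ) (T : NTy) (y : NObj U T) :
    v.upd n T y n T = y := by
  simp [Val.upd]

theorem Val.upd_other {U : Type} (v : Val U) (n : ℕ) (T : NTy) (y : NObj U T) (m T')
    (h : (m, T') ≠ (n, T)) : v.upd n T y m T' = v m T' := by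
  unfold Val.upd
  rw [dif_neg]
  rintro ⟨rfl, rfl⟩
  exact h rfl

/-! ### Semantically presented separators -/

inductive Dfn : Set (ℕ × NTy) → (∀ U : Type, Val U → Prop) → Prop
  | eq {K} (a b : Neu .ur) : a.base ∈ K → b.base ∈ K → Dfn K (fun _ v => a.eval v = b.eval v)
  | ne {K} (a b : Neu .ur) : a.base ∈ K → b.base ∈ K → Dfn K (fun _ v => a.eval v ≠ b.eval v)
  | tru {K} : Dfn K (fun _ _ => True)
  | fls {K} : Dfn K (fun _ _ => False)
  | and {K P Q} : Dfn K P → Dfn K Q → Dfn K (fun U v => P U v ∧ Q U v)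
  | or {K P Q} : Dfn K P → Dfn K Q → Dfn K (fun U v => P U v ∨ Q U v)
  | all {K T P} (n : ℕ) (N : Neu (.set T)) : N.base ∈ K → Dfn (insert (n, T) K) P →
      Dfn K (fun U v => ∀ y ∈ NObj.asSet (N.eval v), P U (v.upd n T y))
  | ex {K T P} (n : ℕ) (N : Neu (.set T)) : N.base ∈ K → Dfn (insert (n, T) K) P →
      Dfn K (fun U v => ∃ y ∈ NObj.asSet (N.eval v), P U (v.upd n T y))

theorem Dfn.neg {K P} (h : Dfn K P) : Dfn K (fun U v => ¬ P U v) := by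
  induction h with
  | eq a b ha hb => exact .ne a b ha hb
  | ne a b ha hb => simpa using Dfn.eq a b ha hb
  | tru => simpa using Dfn.fls
  | fls => simpa using Dfn.tru
  | and _ _ h1 h2 => simpa only [not_and_or] using h1.or h2
  | or _ _ h1 h2 => simpa only [not_or] using h1.and h2
  | all n N hN _ ih =>
    have := Dfn.ex n N hN ih
    simpa only [not_forall, exists_prop] using this
  | ex n N hN _ ih =>
    have := Dfn.all n N hN ih
    simpa only [not_exists, not_and] using this

theorem Dfn.mono {K P} (h : Dfn K P) : ∀ {K'}, K ⊆ K' → Dfn K' P := by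
  induction h with
  | eq a b ha hb => exact fun h => .eq a b (h ha) (h hb)
  | ne a b ha hb => exact fun h => .ne a b (h ha) (h hb)
  | tru => exact fun _ => .tru
  | fls => exact fun _ => .fls
  | and _ _ h1 h2 => exact fun h => (h1 h).and (h2 h)
  | or _ _ h1 h2 => exact fun h => (h1 h).or (h2 h)
  | all n N hN _ ih => exact fun h => .all n N (h hN) (ih (Set.insert_subset_insert h))
  | ex n N hN _ ih => exact fun h => .ex n N (h hN) (ih (Set.insert_subset_insert h))

theorem Val.upd_agree {U : Type} {K : Set (ℕ × NTy)} {v w : Val U}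
    (h : ∀ n T, (n, T) ∈ K → v n T = w n T) (n T) (y : NObj U T) :
    ∀ m T', (m, T') ∈ insert (n, T) K → v.upd n T y m T' = w.upd n T y m T' := by
  intro m T' hm
  by_cases he : (m, T') = (n, T)
  · cases he
    rw [Val.upd_same, Val.upd_same]
  · rw [Val.upd_other _ _ _ _ _ _ he, Val.upd_other _ _ _ _ _ _ he]
    exact h _ _ (hm.resolve_left he)

theorem Dfn.congr {K P} (h : Dfn K P) : ∀ {U : Type} (v w : Val U)
    (_ : ∀ n T, (n, T) ∈ K → v n T = w n T), P U v ↔ P U w := by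
  induction h with
  | eq a b ha hb | ne a b ha hb =>
    intro U v w h
    beta_reduce
    rw [Neu.eval_congr v w h a ha, Neu.eval_congr v w h b hb]
  | tru | fls => intros; rfl
  | and _ _ h1 h2 | or _ _ h1 h2 =>
    intro U v w h
    beta_reduce
    rw [h1 v w h, h2 v w h]
  | all n N hN _ ih | ex n N hN _ ih =>
    intro U v w h
    beta_reduce
    rw [Neu.eval_congr v w h N hN]
    have key := fun y => ih _ _ (Val.upd_agree h n _ y)
    simp only [key]

/-! ### From semantically presented separators to Δ₀ formulas -/

def Tm.weak {S : NTy} {Γ} : ∀ {T}, Tm Γ T → Tm (S :: Γ) T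
  | _, .var i => (Tm.var (Γ := S :: Γ) i.succ : Tm (S :: Γ) (Γ.get i))
  | _, .unit => .unit
  | _, .pair s t => .pair s.weak t.weak
  | _, .fst t => .fst t.weak
  | _, .snd t => .snd t.weak

theorem Tm.weak_fv {S : NTy} {Γ T} (t : Tm Γ T) (F : Finset (Fin Γ.length)) (h : t.fv ⊆ F) :
    ∀ i ∈ (t.weak (S := S)).fv, ∃ j ∈ F, i = Fin.succ j := by
  induction t with
  | var i =>
    intro k hk
    refine ⟨i, h (by simp [Tm.fv]), ?_⟩
    simpa [Tm.weak, Tm.fv] using hk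
  | unit => intro k hk; simp [Tm.weak, Tm.fv] at hk
  | pair s t h1 h2 =>
    intro k hk
    simp only [Tm.weak, Tm.fv, Finset.mem_union] at hk
    rcases hk with hk | hk
    · exact h1 (fun i hi => h (by simp [Tm.fv, hi])) k hk
    · exact h2 (fun i hi => h (by simp [Tm.fv, hi])) k hk
  | fst t ih => simpa only [Tm.fv, Tm.weak] using ih (by simpa only [Tm.fv] using h)
  | snd t ih => simpa only [Tm.fv, Tm.weak] using ih (by simpa only [Tm.fv] using h)

theorem Tm.eval_var {U : Type} {Γ} (i : Fin Γ.length) (ρ : Env U Γ) :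
    (Tm.var i).eval ρ = ρ i := by simp only [Tm.eval]

theorem Tm.eval_unit {U : Type} {Γ} (ρ : Env U Γ) :
    (Tm.unit).eval ρ = () := by simp only [Tm.eval]; rfl

theorem Tm.eval_pair {U : Type} {Γ a b} (s : Tm Γ a) (t : Tm Γ b) (ρ : Env U Γ) :
    (Tm.pair s t).eval ρ = (s.eval ρ, t.eval ρ) := by simp only [Tm.eval]; rfl

theorem Tm.fv_var {Γ : List NTy} (i : Fin Γ.length) : (Tm.var i).fv = {i} := by simp only [Tm.fv]

theorem Tm.weak_eval {U : Type} {S : NTy} {Γ T} (t : Tm Γ T) (x : NObj U S) (ρ : Env U Γ) :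
    t.weak.eval (Env.cons x ρ) = t.eval ρ := by
  induction t with
  | var i =>
    exact (Tm.eval_var (Γ := S :: _) (Fin.succ i) (Env.cons x ρ)).trans (Tm.eval_var i ρ).symm
  | unit => rfl
  | pair s t h1 h2 =>
    refine (Tm.eval_pair _ _ _).trans (Eq.trans ?_ (Tm.eval_pair _ _ _).symm)
    rw [h1, h2]
  | fst t ih => simp only [Tm.weak, Tm.eval, ih]
  | snd t ih => simp only [Tm.weak, Tm.eval, ih]

/-- A family of terms realising the variables in `K`. -/
structure Rlz (K : Set (ℕ × NTy)) (Γ : List NTy) (F : Finset (Fin Γ.length)) where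
  tm : ∀ n T, (n, T) ∈ K → Tm Γ T
  fv : ∀ n T h, (tm n T h).fv ⊆ F

def Rlz.Agree {K Γ F} (R : Rlz K Γ F) {U : Type} (ρ : Env U Γ) (v : Val U) : Prop :=
  ∀ n T h, (R.tm n T h).eval ρ = v n T

theorem Rlz.ne {K Γ F} (R : Rlz K Γ F) {T} (c : Neu T) (hc : c.base ∈ K) :
    ∃ t : Tm Γ T, t.fv ⊆ F ∧ ∀ (U : Type) (ρ : Env U Γ) v, R.Agree ρ v → t.eval ρ = c.eval v := by
  induction c with
  | var n T => exact ⟨R.tm n T hc, R.fv n T hc, fun U ρ v h => h n T hc⟩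
  | fst c ih =>
    obtain ⟨t, h1, h2⟩ := ih hc
    exact ⟨.fst t, by simpa only [Tm.fv] using h1, fun U ρ v h => by simp only [Tm.eval, Neu.eval, h2 U ρ v h]⟩
  | snd c ih =>
    obtain ⟨t, h1, h2⟩ := ih hc
    exact ⟨.snd t, by simpa only [Tm.fv] using h1, fun U ρ v h => by simp only [Tm.eval, Neu.eval, h2 U ρ v h]⟩

def liftF {n : ℕ} (F : Finset (Fin n)) : Finset (Fin (n + 1)) := insert 0 (F.image Fin.succ)

theorem lower_liftF {n : ℕ} (F : Finset (Fin n)) (G) (h : G ⊆ liftF F) : lowerFv G ⊆ F := by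
  intro j hj
  have := h ((mem_lowerFv _ _).1 hj)
  simpa [liftF, Fin.succ_ne_zero] using this

noncomputable def Rlz.lift {K Γ F} (R : Rlz K Γ F) (m : ℕ) (S : NTy) :
    Rlz (insert (m, S) K) (S :: Γ) (liftF F) where
  tm n T h := open Classical in
    if e : S = T ∧ n = m then e.1 ▸ (Tm.var (Γ := S :: Γ) (0 : Fin (Γ.length + 1)) : Tm (S :: Γ) S)
    else (R.tm n T (h.resolve_left (by rintro ⟨rfl, rfl⟩; exact e ⟨rfl, rfl⟩))).weak
  fv n T h := by
    split_ifs with e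
    · obtain ⟨rfl, rfl⟩ := e
      intro i hi
      have hi2 : i ∈ (Tm.var (Γ := S :: Γ) (0 : Fin (Γ.length + 1))).fv := hi
      rw [Tm.fv_var] at hi2
      have hi3 : i = (0 : Fin (Γ.length + 1)) := Finset.mem_singleton.1 hi2
      rw [hi3]
      exact Finset.mem_insert_self _ _
    · intro i hi
      obtain ⟨j, hj, rfl⟩ := Tm.weak_fv _ F (R.fv _ _ _) i hi
      simp [liftF, hj]

theorem Rlz.lift_agree {K Γ F} (R : Rlz K Γ F) (m : ℕ) (S : NTy) {U : Type} (ρ : Env U Γ) v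
    (h : R.Agree ρ v) (y : NObj U S) : (R.lift m S).Agree (Env.cons y ρ) (v.upd m S y) := by
  intro n T hn
  simp only [Rlz.lift]
  split_ifs with e
  · obtain ⟨rfl, rfl⟩ := e
    rw [Val.upd_same]
    exact Tm.eval_var (Γ := S :: Γ) (0 : Fin (Γ.length + 1)) (Env.cons y ρ)
  · rw [Tm.weak_eval, Val.upd_other]
    · exact h _ _ _
    · rintro ⟨rfl, rfl⟩; exact e ⟨rfl, rfl⟩

theorem Dfn.toD0 {K P} (h : Dfn K P) : ∀ {Γ F} (R : Rlz K Γ F),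
    ∃ θ : D0 Γ, θ.fv ⊆ F ∧ ∀ (U : Type) (ρ : Env U Γ) v, R.Agree ρ v → (θ.Sat ρ ↔ P U v) := by
  induction h with
  | eq a b ha hb =>
    intro Γ F R
    obtain ⟨s, hs, hs'⟩ := R.ne a ha
    obtain ⟨t, ht, ht'⟩ := R.ne b hb
    refine ⟨.eq s t, Finset.union_subset hs ht, fun U ρ v h => ?_⟩
    simp only [D0.Sat, hs' U ρ v h, ht' U ρ v h]
  | ne a b ha hb =>
    intro Γ F R
    obtain ⟨s, hs, hs'⟩ := R.ne a ha
    obtain ⟨t, ht, ht'⟩ := R.ne b hb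
    refine ⟨.ne s t, Finset.union_subset hs ht, fun U ρ v h => ?_⟩
    simp only [D0.Sat, hs' U ρ v h, ht' U ρ v h]
  | tru => exact fun R => ⟨.tru, by simp [D0.fv], fun U ρ v h => Iff.rfl⟩
  | fls => exact fun R => ⟨.fls, by simp [D0.fv], fun U ρ v h => Iff.rfl⟩
  | and _ _ h1 h2 =>
    intro Γ F R
    obtain ⟨s, hs, hs'⟩ := h1 R
    obtain ⟨t, ht, ht'⟩ := h2 R
    refine ⟨.and s t, Finset.union_subset hs ht, fun U ρ v h => ?_⟩
    simp only [D0.Sat, hs' U ρ v h, ht' U ρ v h]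
  | or _ _ h1 h2 =>
    intro Γ F R
    obtain ⟨s, hs, hs'⟩ := h1 R
    obtain ⟨t, ht, ht'⟩ := h2 R
    refine ⟨.or s t, Finset.union_subset hs ht, fun U ρ v h => ?_⟩
    simp only [D0.Sat, hs' U ρ v h, ht' U ρ v h]
  | all n N hN _ ih =>
    intro Γ F R
    obtain ⟨s, hs, hs'⟩ := R.ne N hN
    obtain ⟨t, ht, ht'⟩ := ih (R.lift n _)
    refine ⟨.all s t, Finset.union_subset hs (lower_liftF _ _ ht), fun U ρ v h => ?_⟩
    simp only [D0.Sat, hs' U ρ v h]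
    exact forall₂_congr fun y _ => ht' U _ _ (R.lift_agree n _ ρ v h y)
  | ex n N hN _ ih =>
    intro Γ F R
    obtain ⟨s, hs, hs'⟩ := R.ne N hN
    obtain ⟨t, ht, ht'⟩ := ih (R.lift n _)
    refine ⟨.ex s t, Finset.union_subset hs (lower_liftF _ _ ht), fun U ρ v h => ?_⟩
    simp only [D0.Sat, hs' U ρ v h]
    exact exists_congr fun y => and_congr_right fun _ => ht' U _ _ (R.lift_agree n _ ρ v h y)

/-! ### Facts and states -/

inductive Fct : Type
  | fm {Δ : List NTy} (φ : D0 Δ) (σ : PEnv Δ) : Fct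
  | mem {T : NTy} (c : PObj T) (N : Neu (.set T)) : Fct

def Fct.In (K : Set (ℕ × NTy)) : Fct → Prop
  | .fm φ σ => ∀ i ∈ φ.fv, (σ i).In K
  | .mem c N => c.In K ∧ N.base ∈ K

def Fct.Holds {U : Type} (v : Val U) : Fct → Prop
  | .fm φ σ => φ.Sat (σ.eval v)
  | .mem (T := T) c N => PObj.eval v c ∈ NObj.asSet (N.eval v)

theorem Fct.holds_congr {U : Type} {K : Set (ℕ × NTy)} (v w : Val U)
    (h : ∀ n T, (n, T) ∈ K → v n T = w n T) (f : Fct) (hf : f.In K) :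
    f.Holds v ↔ f.Holds w := by
  cases f with
  | fm φ σ =>
    apply D0.sat_congr
    intro i hi
    exact PObj.eval_congr v w h _ _ (hf i hi)
  | mem c N =>
    simp only [Fct.Holds]
    rw [PObj.eval_congr v w h _ _ hf.1, Neu.eval_congr v w h _ hf.2]

theorem Fct.in_mono {K K' : Set (ℕ × NTy)} (h : K ⊆ K') (f : Fct) (hf : f.In K) : f.In K' := by
  cases f with
  | fm φ σ => exact fun i hi => PObj.in_mono h _ _ (hf i hi)
  | mem c N => exact ⟨PObj.in_mono h _ _ hf.1, h hf.2⟩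

structure State where
  bd : ℕ
  tag : Bool → Set (ℕ × NTy)
  fm : Bool → List Fct

/-- common variables -/
def State.K (S : State) : Set (ℕ × NTy) := S.tag true ∩ S.tag false

def State.Mod (S : State) (s : Bool) {U : Type} (v : Val U) : Prop := ∀ f ∈ S.fm s, f.Holds v

def State.Sep (S : State) (s : Bool) : Prop :=
  ∃ P, Dfn S.K P ∧ (∀ U (v : Val U), S.Mod s v → P U v) ∧ (∀ U (v : Val U), S.Mod (!s) v → ¬ P U v)

theorem State.sep_symm {S : State} {s : Bool} (h : S.Sep s) : S.Sep (!s) := by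
  obtain ⟨P, h1, h2, h3⟩ := h
  exact ⟨_, h1.neg, h3, fun U v hv => by rw [Bool.not_not] at hv; exact not_not.2 (h2 U v hv)⟩

structure State.Good (S : State) : Prop where
  inn : ∀ s, ∀ f ∈ S.fm s, f.In (S.tag s)
  bdd : ∀ s, ∀ x ∈ S.tag s, x.1 < S.bd
  com : ∀ s T (c : PObj T) N, Fct.mem c N ∈ S.fm s → N.base ∈ S.tag (!s) →
    Fct.mem c N ∈ S.fm (!s)
  ins : ∀ s, ¬ S.Sep s

def State.Le (S S' : State) : Prop := ∀ s, S.tag s ⊆ S'.tag s ∧ S.fm s ⊆ S'.fm s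

theorem State.Le.refl (S : State) : S.Le S := fun _ => ⟨fun _ h => h, fun _ h => h⟩
theorem State.Le.trans {S S' S'' : State} (h : S.Le S') (h' : S'.Le S'') : S.Le S'' :=
  fun s => ⟨fun _ hx => (h' s).1 ((h s).1 hx), fun _ hx => (h' s).2 ((h s).2 hx)⟩

theorem State.Le.K {S S' : State} (h : S.Le S') : S.K ⊆ S'.K :=
  fun _ hx => ⟨(h true).1 hx.1, (h false).1 hx.2⟩

theorem State.Le.mod {S S' : State} (h : S.Le S') {s} {U : Type} {v : Val U} (hv : S'.Mod s v) :
    S.Mod s v := fun f hf => hv f ((h s).2 hf)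

/-- Add a fact on one side. -/
def State.add1 (S : State) (s : Bool) (f : Fct) : State where
  bd := S.bd
  tag := S.tag
  fm s' := if s' = s then f :: S.fm s' else S.fm s'

theorem State.add1_le (S : State) (s : Bool) (f : Fct) : S.Le (S.add1 s f) := by
  intro s'
  refine ⟨fun _ h => h, ?_⟩
  intro g hg
  simp only [State.add1]
  split_ifs
  · exact List.mem_cons_of_mem _ hg
  · exact hg

theorem State.add1_mem (S : State) (s : Bool) (f : Fct) : f ∈ (S.add1 s f).fm s := by
  simp [State.add1]

theorem State.add1_mod (S : State) (s : Bool) (f : Fct) {U} (v : Val U) (h : S.Mod s v)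
    (hf : f.Holds v) : (S.add1 s f).Mod s v := by
  intro g hg
  simp only [State.add1, if_true, List.mem_cons] at hg
  rcases hg with rfl | hg
  · exact hf
  · exact h g hg

theorem State.add1_mod' (S : State) (s : Bool) (f : Fct) {U} (v : Val U) (h : S.Mod (!s) v) :
    (S.add1 s f).Mod (!s) v := by
  intro g hg
  simp only [State.add1, Bool.not_eq_self, if_false] at hg
  exact h g hg

theorem State.add1_good {S : State} (hS : S.Good) (s : Bool) {Δ} (φ : D0 Δ) (σ : PEnv Δ)
    (hin : (Fct.fm φ σ).In (S.tag s)) (hsep : ¬ (S.add1 s (.fm φ σ)).Sep s) :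
    (S.add1 s (.fm φ σ)).Good where
  inn s' g hg := by
    simp only [State.add1] at hg ⊢
    split_ifs at hg with e
    · subst e
      rcases List.mem_cons.1 hg with rfl | hg
      · exact hin
      · exact hS.inn _ _ hg
    · exact hS.inn _ _ hg
  bdd := hS.bdd
  com s' T c N hm hN := by
    refine (S.add1_le s _ _).2 (hS.com s' T c N ?_ hN)
    simp only [State.add1] at hm
    split_ifs at hm with e
    · simpa using hm
    · exact hm
  ins s' h := by
    by_cases e : s' = s
    · subst e; exact hsep h
    · have : s' = !s := by cases s <;> cases s' <;> simp_all
      subst this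
      have := (State.sep_symm h)
      rw [Bool.not_not] at this
      exact hsep this

/-- Adding a consequence. -/
theorem State.good_conseq {S : State} (hS : S.Good) (s : Bool) {Δ} (φ : D0 Δ) (σ : PEnv Δ)
    (hin : (Fct.fm φ σ).In (S.tag s))
    (hc : ∀ U (v : Val U), S.Mod s v → (Fct.fm φ σ).Holds v) :
    (S.add1 s (.fm φ σ)).Good := by
  refine State.add1_good hS s φ σ hin ?_
  rintro ⟨P, h1, h2, h3⟩
  exact hS.ins s ⟨P, h1, fun U v hv => h2 U v (S.add1_mod s _ v hv (hc U v hv)),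
    fun U v hv => h3 U v (S.add1_mod' s _ v hv)⟩

theorem State.good_or {S : State} (hS : S.Good) (s : Bool) {Δ} (φ ψ : D0 Δ) (σ : PEnv Δ)
    (hin : (Fct.fm φ σ).In (S.tag s)) (hin' : (Fct.fm ψ σ).In (S.tag s))
    (hc : ∀ U (v : Val U), S.Mod s v → (Fct.fm φ σ).Holds v ∨ (Fct.fm ψ σ).Holds v) :
    (S.add1 s (.fm φ σ)).Good ∨ (S.add1 s (.fm ψ σ)).Good := by
  by_contra hcon
  rw [not_or] at hcon
  have a1 : (S.add1 s (.fm φ σ)).Sep s :=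
    by_contra fun h => hcon.1 (State.add1_good hS s φ σ hin h)
  have a2 : (S.add1 s (.fm ψ σ)).Sep s :=
    by_contra fun h => hcon.2 (State.add1_good hS s ψ σ hin' h)
  obtain ⟨P, h1, h2, h3⟩ := a1
  obtain ⟨Q, k1, k2, k3⟩ := a2
  refine hS.ins s ⟨_, Dfn.or h1 k1, fun U v hv => ?_, fun U v hv => ?_⟩
  · rcases hc U v hv with h | h
    · exact Or.inl (h2 U v (S.add1_mod s _ v hv h))
    · exact Or.inr (k2 U v (S.add1_mod s _ v hv h))
  · rintro (h | h)
    · exact h3 U v (S.add1_mod' s _ v hv) h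
    · exact k3 U v (S.add1_mod' s _ v hv) h

/-- Adding a witness. -/
def State.wit (S : State) (s : Bool) {T} (N : Neu (.set T)) {Δ} (φ : D0 (T :: Δ)) (σ : PEnv Δ)
    (b : Prop) [Decidable b] : State where
  bd := S.bd + 1
  tag s' := if s' = s ∨ b then insert (S.bd, T) (S.tag s') else S.tag s'
  fm s' := if s' = s then
      .fm φ (PEnv.cons (reflect T (.var S.bd T)) σ) :: .mem (reflect T (.var S.bd T)) N :: S.fm s'
    else if b then .mem (reflect T (.var S.bd T)) N :: S.fm s' else S.fm s'

theorem in_cons {K : Set (ℕ × NTy)} {T Δ} (φ : D0 (T :: Δ)) (σ : PEnv Δ) (c : PObj T)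
    (hc : c.In K) (h : ∀ i ∈ lowerFv φ.fv, (σ i).In K) : (Fct.fm φ (PEnv.cons c σ)).In K := by
  intro i
  refine Fin.cases ?_ (fun j => ?_) i
  · intro _; exact hc
  · intro hj; exact h j ((mem_lowerFv _ _).2 hj)

theorem State.wit_le (S : State) (s : Bool) {T} (N : Neu (.set T)) {Δ} (φ : D0 (T :: Δ))
    (σ : PEnv Δ) (b : Prop) [Decidable b] : S.Le (S.wit s N φ σ b) := by
  intro s'
  constructor
  · intro x hx
    simp only [State.wit]
    split_ifs
    · exact Or.inr hx
    · exact hx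
  · intro x hx
    simp only [State.wit]
    split_ifs <;> simp [hx]

theorem State.Good.upd_mod {S : State} (hS : S.Good) (s : Bool) {U} (v : Val U) {T} (y : NObj U T)
    (h : S.Mod s v) : S.Mod s (v.upd S.bd T y) := by
  intro f hf
  refine (Fct.holds_congr (K := S.tag s) v _ (fun n T' hn => ?_) f (hS.inn s f hf)).1 (h f hf)
  rw [Val.upd_other]
  intro e
  have := hS.bdd s _ hn
  cases e
  exact lt_irrefl _ this

theorem State.Good.upd_ne {S : State} (hS : S.Good) (s : Bool) {U} (v : Val U) {T} (y : NObj U T)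
    {T'} (N : Neu T') (hN : N.base ∈ S.tag s) : N.eval (v.upd S.bd T y) = N.eval v := by
  refine Neu.eval_congr (K := S.tag s) _ _ (fun n T' hn => ?_) N hN
  rw [Val.upd_other]
  intro e
  have := hS.bdd s _ hn
  cases e
  exact lt_irrefl _ this

theorem State.good_ex {S : State} (hS : S.Good) (s : Bool) {T Δ} (t : Tm Δ (.set T))
    (φ : D0 (T :: Δ)) (σ : PEnv Δ) (hm : Fct.fm (.ex t φ) σ ∈ S.fm s) :
    ∃ S' : State, S.Le S' ∧ S'.Good ∧ ∃ c, Fct.mem c (t.peval σ).toNe ∈ S'.fm s ∧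
      Fct.fm φ (PEnv.cons c σ) ∈ S'.fm s := by
  classical
  have hin := hS.inn s _ hm
  set N := (t.peval σ).toNe with hNdef
  have hN : N.base ∈ S.tag s := Tm.peval_in (K := S.tag s) t σ fun i hi =>
    hin i (by simp [D0.fv, hi])
  set b : Prop := N.base ∈ S.tag (!s) with hb
  have hss : ∀ s', s' = s ∨ s' = !s := by intro s'; cases s <;> cases s' <;> simp
  refine ⟨S.wit s N φ σ b, S.wit_le s N φ σ b, ?_, reflect T (.var S.bd T), ?_, ?_⟩
  swap
  · simp [State.wit]
  swap
  · simp [State.wit]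
  have hle := S.wit_le s N φ σ b
  -- the main separation argument
  have main : ¬ (S.wit s N φ σ b).Sep s := by
    rintro ⟨P, h1, h2, h3⟩
    have hNs : ∀ (U : Type) (v : Val U), N.eval v = t.eval (σ.eval v) := fun U v =>
      Tm.peval_eval v t σ
    have modS : ∀ (U : Type) (v : Val U), S.Mod s v → ∃ y ∈ NObj.asSet (N.eval v),
        (S.wit s N φ σ b).Mod s (v.upd S.bd T y) := by
      intro U v hv
      obtain ⟨y, hy, hφ⟩ := hv _ hm
      rw [← hNs] at hy
      refine ⟨y, hy, ?_⟩
      intro g hg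
      simp only [State.wit, if_true, List.mem_cons] at hg
      rcases hg with rfl | rfl | hg
      · simp only [Fct.Holds]
        rw [PEnv.eval_cons, reflect_eval]
        simp only [Neu.eval, Val.upd_same]
        refine (D0.sat_congr _ _ _ ?_).1 hφ
        intro i
        refine Fin.cases ?_ (fun j => ?_) i
        · intro _; rfl
        · intro hj
          refine PObj.eval_congr (K := S.tag s) v _ (fun n T' hn => ?_) _ _ (hin j ?_)
          · rw [Val.upd_other]
            intro e
            have := hS.bdd s _ hn
            cases e
            exact lt_irrefl _ this
          · simp only [D0.fv, Finset.mem_union]; right; exact (mem_lowerFv _ _).2 hj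
      · simp only [Fct.Holds]
        rw [reflect_eval, hS.upd_ne s v y N hN]
        simpa only [Neu.eval, Val.upd_same] using hy
      · exact hS.upd_mod s v y hv g hg
    by_cases hbb : b
    · have hK : (S.wit s N φ σ b).K = insert (S.bd, T) S.K := by
        ext x
        simp only [State.K, State.wit, hbb, or_true, if_true, Set.mem_inter_iff,
          Set.mem_insert_iff]
        tauto
      rw [hK] at h1
      have hNK : N.base ∈ S.K := by
        cases s
        · exact ⟨hbb, hN⟩
        · exact ⟨hN, hbb⟩
      refine hS.ins s ⟨_, Dfn.ex S.bd N hNK h1, fun U v hv => ?_, fun U v hv => ?_⟩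
      · obtain ⟨y, hy, hv'⟩ := modS U v hv
        exact ⟨y, hy, h2 U _ hv'⟩
      · rintro ⟨y, hy, hP⟩
        refine h3 U _ ?_ hP
        intro g hg
        simp only [State.wit, Bool.not_eq_self, if_false, hbb, if_true, List.mem_cons] at hg
        rcases hg with rfl | hg
        · simp only [Fct.Holds]
          rw [reflect_eval, hS.upd_ne s v y N hN]
          simpa only [Neu.eval, Val.upd_same] using hy
        · exact hS.upd_mod (!s) v y hv g hg
    · have hfresh : ∀ s', (S.bd, T) ∉ S.tag s' := fun s' h => lt_irrefl _ (hS.bdd s' _ h)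
      have hK : (S.wit s N φ σ b).K = S.K := by
        ext x
        simp only [State.K, State.wit, hbb, or_false, Set.mem_inter_iff]
        cases s
        · simp only [Bool.true_eq_false, if_false, if_true, Set.mem_insert_iff]
          constructor
          · rintro ⟨h, rfl | h'⟩
            · exact absurd h (hfresh _)
            · exact ⟨h, h'⟩
          · rintro ⟨h, h'⟩; exact ⟨h, Or.inr h'⟩
        · simp only [Bool.false_eq_true, if_false, if_true, Set.mem_insert_iff]
          constructor
          · rintro ⟨rfl | h', h⟩
            · exact absurd h (hfresh _)
            · exact ⟨h', h⟩
          · rintro ⟨h, h'⟩; exact ⟨Or.inr h, h'⟩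
      rw [hK] at h1
      refine hS.ins s ⟨P, h1, fun U v hv => ?_, fun U v hv => ?_⟩
      · obtain ⟨y, hy, hv'⟩ := modS U v hv
        refine (h1.congr _ _ fun n T' hn => ?_).1 (h2 U _ hv')
        rw [Val.upd_other]
        intro e
        cases e
        exact hfresh _ hn.1
      · refine h3 U v ?_
        intro g hg
        simp only [State.wit, Bool.not_eq_self, if_false, hbb] at hg
        exact hv g hg
  constructor
  · intro s' f hf
    rcases hss s' with rfl | rfl
    · have hx : (S.bd, T) ∈ (S.wit s' N φ σ b).tag s' := by simp [State.wit]
      simp only [State.wit, if_true, List.mem_cons] at hf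
      rcases hf with rfl | rfl | hf
      · refine in_cons _ _ _ (reflect_in _ _ _ hx) fun i hi => ?_
        exact PObj.in_mono (hle s').1 _ _ (hin i (by simp [D0.fv, hi]))
      · exact ⟨reflect_in _ _ _ hx, (hle s').1 hN⟩
      · exact Fct.in_mono (hle s').1 _ (hS.inn _ _ hf)
    · simp only [State.wit, Bool.not_eq_self, if_false] at hf
      split_ifs at hf with hbb
      · have hx : (S.bd, T) ∈ (S.wit s N φ σ b).tag (!s) := by simp [State.wit, hbb]
        rcases List.mem_cons.1 hf with rfl | hf
        · exact ⟨reflect_in _ _ _ hx, (hle _).1 hbb⟩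
        · exact Fct.in_mono (hle _).1 _ (hS.inn _ _ hf)
      · exact Fct.in_mono (hle _).1 _ (hS.inn _ _ hf)
  · intro s' x hx
    simp only [State.wit] at hx ⊢
    split_ifs at hx
    · rcases hx with rfl | hx
      · exact Nat.lt_succ_self _
      · exact Nat.lt_succ_of_lt (hS.bdd _ _ hx)
    · exact Nat.lt_succ_of_lt (hS.bdd _ _ hx)
  · intro s' T' c M hM hMb
    -- either an old membership fact, or the new one
    have hcases : Fct.mem c M ∈ S.fm s' ∨
        (Fct.mem c M = Fct.mem (reflect T (.var S.bd T)) N ∧ (s' = s ∨ b)) := by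
      rcases hss s' with rfl | rfl
      · simp only [State.wit, if_true, List.mem_cons] at hM
        rcases hM with hM | hM | hM
        · cases hM
        · exact Or.inr ⟨hM, Or.inl rfl⟩
        · exact Or.inl hM
      · simp only [State.wit, Bool.not_eq_self, if_false] at hM
        split_ifs at hM with hbb
        · rcases List.mem_cons.1 hM with hM | hM
          · exact Or.inr ⟨hM, Or.inr hbb⟩
          · exact Or.inl hM
        · exact Or.inl hM
    have hold : ∀ s'' s₀, ∀ M' : Neu (.set T'), M'.base ∈ S.tag s₀ →
        M'.base ∈ (S.wit s N φ σ b).tag s'' → M'.base ∈ S.tag s'' := by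
      intro s'' s₀ M' h0 h
      simp only [State.wit] at h
      split_ifs at h
      · rcases h with h | h
        · exact absurd (hS.bdd _ _ h0) (by rw [h]; exact lt_irrefl _)
        · exact h
      · exact h
    rcases hcases with h | ⟨h, h'⟩
    · have hMs := (hS.inn _ _ h).2
      exact (hle _).2 (hS.com s' T' c M h (hold _ _ M hMs hMb))
    · have : b := by
        rcases h' with rfl | h'
        · cases h
          exact hold _ _ N hN hMb
        · exact h'
      rw [h]
      rcases hss (!s') with e | e <;> rw [e] <;> simp [State.wit, this]
  · intro s' h
    rcases hss s' with rfl | rfl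
    · exact main h
    · have := (State.sep_symm h)
      rw [Bool.not_not] at this
      exact main this

/-! ### One sat_round of saturation -/

def GoalD (S : State) (s : Bool) (m : Fct) : ∀ {Δ}, D0 Δ → PEnv Δ → Prop
  | _, .and φ ψ, σ => Fct.fm φ σ ∈ S.fm s ∧ Fct.fm ψ σ ∈ S.fm s
  | _, .or φ ψ, σ => Fct.fm φ σ ∈ S.fm s ∨ Fct.fm ψ σ ∈ S.fm s
  | _, .all t φ, σ => ∀ c, m = Fct.mem c (t.peval σ).toNe → Fct.fm φ (PEnv.cons c σ) ∈ S.fm s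
  | _, .ex t φ, σ => ∃ c, Fct.mem c (t.peval σ).toNe ∈ S.fm s ∧
      Fct.fm φ (PEnv.cons c σ) ∈ S.fm s
  | _, _, _ => True

def Goal (S : State) (s : Bool) (m : Fct) : Fct → Prop
  | .fm φ σ => GoalD S s m φ σ
  | .mem _ _ => True

theorem Goal.mono {S S' : State} (h : S.Le S') (s m f) (hg : Goal S s m f) : Goal S' s m f := by
  cases f with
  | mem c N => trivial
  | fm φ σ =>
    cases φ with
    | and φ ψ => exact ⟨(h s).2 hg.1, (h s).2 hg.2⟩
    | or φ ψ => exact hg.imp (fun x => (h s).2 x) (fun x => (h s).2 x)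
    | all t φ => exact fun c hc => (h s).2 (hg c hc)
    | ex t φ =>
      obtain ⟨c, h1, h2⟩ := hg
      exact ⟨c, (h s).2 h1, (h s).2 h2⟩
    | _ => trivial

theorem Goal.attain {S : State} (hS : S.Good) (s m f) (hf : f ∈ S.fm s) (hm : m ∈ S.fm s) :
    ∃ S' : State, S.Le S' ∧ S'.Good ∧ Goal S' s m f := by
  cases f with
  | mem c N => exact ⟨S, .refl S, hS, trivial⟩
  | fm φ σ =>
    have hin := hS.inn s _ hf
    cases φ with
    | and φ ψ =>
      have h1 := State.good_conseq hS s φ σ (fun i hi => hin i (by simp [D0.fv, hi]))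
        fun U v hv => (hv _ hf).1
      have h2 := State.good_conseq h1 s ψ σ (fun i hi => hin i (by simp [D0.fv, hi]))
        fun U v hv => ((S.add1_le s _).mod hv _ hf).2
      exact ⟨_, (S.add1_le _ _).trans (State.add1_le _ _ _), h2,
        (State.add1_le _ _ _ _).2 (State.add1_mem _ _ _), State.add1_mem _ _ _⟩
    | or φ ψ =>
      rcases State.good_or hS s φ ψ σ (fun i hi => hin i (by simp [D0.fv, hi]))
        (fun i hi => hin i (by simp [D0.fv, hi])) (fun U v hv => hv _ hf) with h | h
      · exact ⟨_, S.add1_le _ _, h, Or.inl (State.add1_mem _ _ _)⟩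
      · exact ⟨_, S.add1_le _ _, h, Or.inr (State.add1_mem _ _ _)⟩
    | all t φ =>
      by_cases hc : ∃ c, m = Fct.mem c (t.peval σ).toNe
      · obtain ⟨c, rfl⟩ := hc
        refine ⟨_, S.add1_le _ _, State.good_conseq hS s φ (PEnv.cons c σ) ?_ ?_, ?_⟩
        · exact in_cons _ _ _ (hS.inn _ _ hm).1 fun i hi => hin i (by simp [D0.fv, hi])
        · intro U v hv
          have h1 := hv _ hf
          have h2 := hv _ hm
          simp only [Fct.Holds] at h1 h2 ⊢
          rw [PEnv.eval_cons]
          refine h1 _ ?_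
          rw [← Tm.peval_eval]
          exact h2
        · intro c' hc'
          cases hc'
          exact State.add1_mem _ _ _
      · exact ⟨S, .refl S, hS, fun c h => absurd ⟨c, h⟩ hc⟩
    | ex t φ =>
      obtain ⟨S', h1, h2, h3⟩ := State.good_ex hS s t φ σ hf
      exact ⟨S', h1, h2, h3⟩
    | _ => exact ⟨S, .refl S, hS, trivial⟩

theorem round_list (S₀ : State) (l : List (Bool × Fct × Fct))
    (hl : ∀ x ∈ l, x.2.1 ∈ S₀.fm x.1 ∧ x.2.2 ∈ S₀.fm x.1) :
    S₀.Good → ∃ S' : State, S₀.Le S' ∧ S'.Good ∧ ∀ x ∈ l, Goal S' x.1 x.2.1 x.2.2 := by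
  intro h0
  induction l with
  | nil => exact ⟨S₀, .refl _, h0, by simp⟩
  | cons x l ih =>
    obtain ⟨S', h1, h2, h3⟩ := ih fun y hy => hl y (List.mem_cons_of_mem _ hy)
    obtain ⟨hx1, hx2⟩ := hl x (by simp)
    obtain ⟨S'', k1, k2, k3⟩ := Goal.attain h2 x.1 x.2.1 x.2.2 ((h1 _).2 hx2) ((h1 _).2 hx1)
    refine ⟨S'', h1.trans k1, k2, ?_⟩
    intro y hy
    rcases List.mem_cons.1 hy with rfl | hy
    · exact k3
    · exact Goal.mono k1 _ _ _ (h3 y hy)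

theorem sat_round (S : State) (hS : S.Good) : ∃ S' : State, S.Le S' ∧ S'.Good ∧
    ∀ s, ∀ f ∈ S.fm s, ∀ m ∈ S.fm s, Goal S' s m f := by
  let g : Bool → List (Bool × Fct × Fct) := fun s =>
    ((S.fm s).product (S.fm s)).map fun p => (s, p)
  have hg : ∀ s x, x ∈ g s ↔ x.1 = s ∧ x.2.1 ∈ S.fm s ∧ x.2.2 ∈ S.fm s := by
    rintro s ⟨s', m, f⟩
    simp only [g, List.mem_map, Prod.exists, Prod.mk.injEq]
    constructor
    · rintro ⟨a, b, h, rfl, rfl, rfl⟩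
      exact ⟨rfl, List.mem_product.1 h⟩
    · rintro ⟨rfl, h1, h2⟩
      exact ⟨_, _, List.mem_product.2 ⟨h1, h2⟩, rfl, rfl, rfl⟩
  obtain ⟨S', h1, h2, h3⟩ := round_list S (g true ++ g false) (by
    intro x hx
    rcases List.mem_append.1 hx with hx | hx <;> rw [hg] at hx <;> rw [hx.1] <;> exact hx.2) hS
  refine ⟨S', h1, h2, fun s f hf m hm => h3 (s, m, f) ?_⟩
  rw [List.mem_append]
  cases s
  · exact Or.inr ((hg _ _).2 ⟨rfl, hm, hf⟩)
  · exact Or.inl ((hg _ _).2 ⟨rfl, hm, hf⟩)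

/-! ### The limit model -/

structure Chain where
  S : ℕ → State
  good : ∀ n, (S n).Good
  le : ∀ n, (S n).Le (S (n + 1))
  goal : ∀ n s, ∀ f ∈ (S n).fm s, ∀ m ∈ (S n).fm s, Goal (S (n + 1)) s m f

theorem exists_chain (S : State) (hS : S.Good) : ∃ C : Chain, C.S 0 = S := by
  choose f h1 h2 h3 using sat_round
  let seq : ℕ → {S : State // S.Good} := fun n =>
    Nat.rec ⟨S, hS⟩ (fun _ x => ⟨f x.1 x.2, h2 x.1 x.2⟩) n
  exact ⟨⟨fun n => (seq n).1, fun n => (seq n).2, fun n => h1 _ (seq n).2,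
    fun n => h3 _ (seq n).2⟩, rfl⟩

namespace Chain
variable (C : Chain)

theorem le' {m n : ℕ} (h : m ≤ n) : (C.S m).Le (C.S n) := by
  induction h with
  | refl => exact .refl _
  | step _ ih => exact ih.trans (C.le _)

def Fm (s : Bool) (f : Fct) : Prop := ∃ n, f ∈ (C.S n).fm s
def Tag (s : Bool) (x : ℕ × NTy) : Prop := ∃ n, x ∈ (C.S n).tag s

def E (s : Bool) (a b : Neu .ur) : Prop := ∃ n P, Dfn (C.S n).K P ∧
  (∀ U (v : Val U), (C.S n).Mod (!s) v → P U v) ∧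
  (∀ U (v : Val U), (C.S n).Mod s v → P U v → a.eval v = b.eval v)

theorem E.refl (s a) : C.E s a a := ⟨0, _, .tru, fun _ _ _ => trivial, fun _ _ _ _ => rfl⟩

variable {C}

theorem E.symm {s a b} (h : C.E s a b) : C.E s b a := by
  obtain ⟨n, P, h1, h2, h3⟩ := h
  exact ⟨n, P, h1, h2, fun U v hv hP => (h3 U v hv hP).symm⟩

theorem E.trans {s a b c} (h : C.E s a b) (h' : C.E s b c) : C.E s a c := by
  obtain ⟨n, P, h1, h2, h3⟩ := h
  obtain ⟨m, Q, k1, k2, k3⟩ := h'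
  have l1 := C.le' (le_max_left n m)
  have l2 := C.le' (le_max_right n m)
  exact ⟨max n m, _, (h1.mono l1.K).and (k1.mono l2.K),
    fun U v hv => ⟨h2 U v (l1.mod hv), k2 U v (l2.mod hv)⟩,
    fun U v hv hP => (h3 U v (l1.mod hv) hP.1).trans (k3 U v (l2.mod hv) hP.2)⟩

theorem tag_common {x} {s : Bool} (h : C.Tag s x) (h' : C.Tag (!s) x) : ∃ n, x ∈ (C.S n).K := by
  obtain ⟨n, hn⟩ := h
  obtain ⟨m, hm⟩ := h'
  have l1 := C.le' (le_max_left n m)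
  have l2 := C.le' (le_max_right n m)
  refine ⟨max n m, ?_⟩
  cases s
  · exact ⟨(l2 _).1 hm, (l1 _).1 hn⟩
  · exact ⟨(l1 _).1 hn, (l2 _).1 hm⟩

theorem E.swap {s : Bool} {a b : Neu .ur} (h : C.E s a b) (ha : C.Tag s a.base)
    (ha' : C.Tag (!s) a.base) (hb : C.Tag s b.base) (hb' : C.Tag (!s) b.base) :
    C.E (!s) a b := by
  obtain ⟨n, P, h1, h2, h3⟩ := h
  obtain ⟨m, hm⟩ := tag_common ha ha'
  obtain ⟨k, hk⟩ := tag_common hb hb'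
  have l1 := C.le' (show n ≤ n + m + k by omega)
  have l2 := C.le' (show m ≤ n + m + k by omega)
  have l3 := C.le' (show k ≤ n + m + k by omega)
  refine ⟨n + m + k, _, (h1.mono l1.K).neg.or (Dfn.eq a b (l2.K hm) (l3.K hk)), ?_, ?_⟩
  · intro U v hv
    rw [Bool.not_not] at hv
    by_cases hP : P U v
    · exact Or.inr (h3 U v (l1.mod hv) hP)
    · exact Or.inl hP
  · intro U v hv hP
    exact hP.resolve_left (not_not.2 (h2 U v (l1.mod hv)))

variable (C)

def r (a b : Neu .ur) : Prop := ∃ s, C.Tag s a.base ∧ C.Tag s b.base ∧ C.E s a b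

theorem r_symm {a b} (h : C.r a b) : C.r b a := by
  obtain ⟨s, h1, h2, h3⟩ := h
  exact ⟨s, h2, h1, h3.symm⟩

def Q (s : Bool) (a b : Neu .ur) : Prop :=
  (C.Tag s b.base → C.E s a b) ∧
  (C.Tag (!s) b.base → ∃ c : Neu .ur, C.Tag s c.base ∧ C.Tag (!s) c.base ∧ C.E s a c ∧ C.E (!s) c b)

theorem Q_step (s : Bool) (a b d : Neu .ur) (hQ : C.Q s a b) (h : C.r b d) : C.Q s a d := by
  obtain ⟨s', hb, hd, he⟩ := h
  have hss : s' = s ∨ s' = !s := by cases s <;> cases s' <;> simp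
  rcases hss with rfl | rfl
  · have := (hQ.1 hb).trans he
    exact ⟨fun _ => this, fun hd' => ⟨d, hd, hd', this, E.refl _ _ _⟩⟩
  · obtain ⟨c, c1, c2, c3, c4⟩ := hQ.2 hb
    have h4 := c4.trans he
    refine ⟨fun hd' => ?_, fun _ => ⟨c, c1, c2, c3, h4⟩⟩
    have := h4.swap c2 (by rwa [Bool.not_not]) hd (by rwa [Bool.not_not])
    rw [Bool.not_not] at this
    exact c3.trans this

theorem eqvGen_E (s : Bool) (a b : Neu .ur) (ha : C.Tag s a.base) (hb : C.Tag s b.base)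
    (h : Relation.EqvGen C.r a b) : C.E s a b := by
  have key : ∀ x y, Relation.EqvGen C.r x y → (C.Q s a x ↔ C.Q s a y) := by
    intro x y hxy
    induction hxy with
    | rel x y h => exact ⟨fun hq => C.Q_step s a x y hq h, fun hq => C.Q_step s a y x hq (C.r_symm h)⟩
    | refl x => rfl
    | symm x y _ ih => exact ih.symm
    | trans x y z _ _ h1 h2 => exact h1.trans h2
  refine ((key a b h).1 ⟨fun _ => E.refl _ _ _, fun ha' => ?_⟩).1 hb
  exact ⟨a, ha, ha', E.refl _ _ _, E.refl _ _ _⟩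

abbrev Un : Type := Quot C.r

def den : ∀ T, PObj T → NObj C.Un T
  | .ur => fun c => Quot.mk C.r c
  | .unit => fun _ => ()
  | .prod a b => fun c => (den a c.1, den b c.2)
  | .set a => fun N => ({y | ∃ c : PObj a, (∃ s, C.Fm s (.mem c N.toNe)) ∧ den a c = y} :
      Set (NObj C.Un a))

def denE {Δ} (σ : PEnv Δ) : Env C.Un Δ := fun i => C.den _ (σ i)

theorem denE_cons {Δ T} (c : PObj T) (σ : PEnv Δ) :
    C.denE (PEnv.cons c σ) = Env.cons (C.den T c) (C.denE σ) := by
  funext i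
  refine Fin.cases ?_ (fun j => ?_) i <;> rfl

theorem den_peval {Γ T} (t : Tm Γ T) (σ : PEnv Γ) :
    C.den T (t.peval σ) = t.eval (C.denE σ) := by
  induction t with
  | var i => simp only [Tm.eval]; rfl
  | unit => simp only [Tm.eval]; rfl
  | pair s t h1 h2 => simp only [Tm.peval, Tm.eval, ← h1, ← h2]; rfl
  | fst t ih => simp only [Tm.peval, Tm.eval, ← ih]; rfl
  | snd t ih => simp only [Tm.peval, Tm.eval, ← ih]; rfl

theorem goal' {s f m} (hf : C.Fm s f) (hm : C.Fm s m) : ∃ n, Goal (C.S n) s m f := by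
  obtain ⟨n, hn⟩ := hf
  obtain ⟨k, hk⟩ := hm
  exact ⟨_, C.goal (max n k) s f ((C.le' (le_max_left n k) _).2 hn) m
    ((C.le' (le_max_right n k) _).2 hk)⟩

theorem truth {Δ} (φ : D0 Δ) : ∀ (σ : PEnv Δ) (s : Bool), C.Fm s (.fm φ σ) →
    φ.Sat (C.denE σ) := by
  induction φ with
  | eq a b =>
    rintro σ s ⟨n, hn⟩
    have hin := (C.good n).inn s _ hn
    simp only [D0.Sat, ← den_peval]
    refine Quot.sound ⟨s, ⟨n, ?_⟩, ⟨n, ?_⟩, n, _, .tru, fun _ _ _ => trivial, fun U v hv _ => ?_⟩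
    · exact Tm.peval_in (K := (C.S n).tag s) a σ fun i hi => hin i (by simp [D0.fv, hi])
    · exact Tm.peval_in (K := (C.S n).tag s) b σ fun i hi => hin i (by simp [D0.fv, hi])
    · have := hv _ hn
      simp only [Fct.Holds, D0.Sat, ← Tm.peval_eval] at this
      exact this
  | ne a b =>
    rintro σ s ⟨n, hn⟩
    have hin := (C.good n).inn s _ hn
    simp only [D0.Sat, ← den_peval]
    intro heq
    have hE := C.eqvGen_E s (a.peval σ).toUr (b.peval σ).toUr
      ⟨n, Tm.peval_in (K := (C.S n).tag s) a σ fun i hi => hin i (by simp [D0.fv, hi])⟩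
      ⟨n, Tm.peval_in (K := (C.S n).tag s) b σ fun i hi => hin i (by simp [D0.fv, hi])⟩
      (Quot.eqvGen_exact heq)
    obtain ⟨m, P, h1, h2, h3⟩ := hE
    have l1 := C.le' (le_max_left n m)
    have l2 := C.le' (le_max_right n m)
    refine (C.good (max n m)).ins (!s) ⟨P, h1.mono l2.K, fun U v hv => h2 U v (l2.mod hv),
      fun U v hv hP => ?_⟩
    rw [Bool.not_not] at hv
    have := l1.mod hv _ hn
    simp only [Fct.Holds, D0.Sat, ← Tm.peval_eval] at this
    exact this (h3 U v (l2.mod hv) hP)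
  | tru => intros; trivial
  | fls =>
    rintro σ s ⟨n, hn⟩
    exact ((C.good n).ins s ⟨_, .fls, fun U v hv => hv _ hn, fun _ _ _ h => h⟩).elim
  | and φ ψ h1 h2 =>
    intro σ s h
    obtain ⟨n, hn⟩ := C.goal' h h
    exact ⟨h1 σ s ⟨n, hn.1⟩, h2 σ s ⟨n, hn.2⟩⟩
  | or φ ψ h1 h2 =>
    intro σ s h
    obtain ⟨n, hn⟩ := C.goal' h h
    exact hn.imp (fun hn => h1 σ s ⟨n, hn⟩) (fun hn => h2 σ s ⟨n, hn⟩)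
  | all t φ ih =>
    intro σ s h
    simp only [D0.Sat, ← den_peval]
    rintro _ ⟨c, ⟨s', hc⟩, rfl⟩
    have hcs : C.Fm s (.mem c (t.peval σ).toNe) := by
      have hss : s' = s ∨ s' = !s := by cases s <;> cases s' <;> simp
      rcases hss with rfl | rfl
      · exact hc
      · obtain ⟨n, hn⟩ := h
        obtain ⟨k, hk⟩ := hc
        have l1 := C.le' (le_max_left n k)
        have l2 := C.le' (le_max_right n k)
        have hin := (C.good n).inn s _ hn
        have hN : ((t.peval σ).toNe).base ∈ (C.S n).tag s :=
          Tm.peval_in (K := (C.S n).tag s) t σ fun i hi => hin i (by simp [D0.fv, hi])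
        have := (C.good (max n k)).com (!s) _ c _ ((l2 _).2 hk)
          (by rw [Bool.not_not]; exact (l1 _).1 hN)
        rw [Bool.not_not] at this
        exact ⟨_, this⟩
    obtain ⟨n, hn⟩ := C.goal' h hcs
    rw [← denE_cons]
    exact ih _ s ⟨n, hn c rfl⟩
  | ex t φ ih =>
    intro σ s h
    simp only [D0.Sat, ← den_peval]
    obtain ⟨n, c, h1, h2⟩ := C.goal' h h
    refine ⟨C.den _ c, ⟨c, ⟨s, n, h1⟩, rfl⟩, ?_⟩
    rw [← denE_cons]
    exact ih _ s ⟨n, h2⟩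

end Chain

/-! ### Conclusion -/

theorem nobj_nonempty (U : Type) [Nonempty U] : ∀ T, Nonempty (NObj U T)
  | .ur => (inferInstance : Nonempty U)
  | .unit => ⟨()⟩
  | .prod a b => by
    obtain ⟨x⟩ := nobj_nonempty U a
    obtain ⟨y⟩ := nobj_nonempty U b
    exact ⟨(x, y)⟩
  | .set a => ⟨(∅ : Set (NObj U a))⟩

def initEnv (Γ : List NTy) : PEnv Γ := fun i => reflect _ (.var i.val (Γ.get i))

theorem exists_val {U : Type} [Nonempty U] {Γ : List NTy} (ρ : Env U Γ) :
    ∃ v : Val U, ∀ i : Fin Γ.length, v i.val (Γ.get i) = ρ i := by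
  classical
  have hne := nobj_nonempty U
  refine ⟨fun n T => if h : ∃ hn : n < Γ.length, Γ.get ⟨n, hn⟩ = T then h.2 ▸ ρ ⟨n, h.1⟩
    else Classical.choice (hne T), fun i => ?_⟩
  exact dif_pos (c := ∃ hn : i.val < Γ.length, Γ.get ⟨i.val, hn⟩ = Γ.get i) ⟨i.2, rfl⟩

def initTag {Γ : List NTy} (F : Finset (Fin Γ.length)) : Set (ℕ × NTy) :=
  {x | ∃ i ∈ F, x = (i.val, Γ.get i)}

def initState {Γ : List NTy} (φ ψ : D0 Γ) : State where
  bd := Γ.length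
  tag s := initTag (if s then φ.fv else ψ.fv)
  fm s := [.fm (if s then φ else ψ) (initEnv Γ)]

theorem init_sep {Γ : List NTy} (φ ψ : D0 Γ)
    (h : ∀ (U : Type) (ρ : Env U Γ), φ.Sat ρ → ψ.Sat ρ → False) : (initState φ ψ).Sep true := by
  by_contra hcon
  have good : (initState φ ψ).Good := by
    constructor
    · intro s f hf
      simp only [initState, List.mem_singleton] at hf
      subst hf
      intro i hi
      refine reflect_in _ _ _ ⟨i, ?_, rfl⟩
      cases s <;> simpa using hi
    · rintro s _ ⟨i, _, rfl⟩
      exact i.2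
    · intro s T c N hm
      simp [initState] at hm
    · intro s hs
      cases s
      · exact hcon (State.sep_symm hs)
      · exact hcon hs
  obtain ⟨C, hC⟩ := exists_chain _ good
  refine h _ (C.denE (initEnv Γ)) (C.truth φ _ true ⟨0, ?_⟩) (C.truth ψ _ false ⟨0, ?_⟩)
  · simp [hC, initState]
  · simp [hC, initState]

theorem real_init {Γ : List NTy} (F : Finset (Fin Γ.length)) (K : Set (ℕ × NTy))
    (hK : K ⊆ initTag F) : ∃ R : Rlz K Γ F, ∀ (U : Type) (ρ : Env U Γ) (v : Val U),
      (∀ i : Fin Γ.length, v i.val (Γ.get i) = ρ i) → R.Agree ρ v := by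
  have : ∀ n T, (n, T) ∈ K → ∃ t : Tm Γ T, t.fv ⊆ F ∧ ∀ (U : Type) (ρ : Env U Γ) (v : Val U),
      (∀ i : Fin Γ.length, v i.val (Γ.get i) = ρ i) → t.eval ρ = v n T := by
    intro n T hn
    obtain ⟨i, hi, e⟩ := hK hn
    cases e
    exact ⟨.var i, by simpa [Tm.fv] using hi, fun U ρ v h => (Tm.eval_var i ρ).trans (h i).symm⟩
  choose tm h1 h2 using this
  exact ⟨⟨tm, h1⟩, fun U ρ v h n T hn => h2 n T hn U ρ v h⟩

theorem interp_aux {Γ : List NTy} (φ ψ : D0 Γ)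
    (h : ∀ (U : Type) (ρ : Env U Γ), φ.Sat ρ → ψ.Sat ρ → False) :
    ∃ θ : D0 Γ, θ.fv ⊆ φ.fv ∩ ψ.fv ∧
      (∀ (U : Type) (ρ : Env U Γ), φ.Sat ρ → θ.Sat ρ) ∧
      (∀ (U : Type) (ρ : Env U Γ), θ.Sat ρ → ψ.Sat ρ → False) := by
  obtain ⟨P, h1, h2, h3⟩ := init_sep φ ψ h
  obtain ⟨R, hR⟩ := real_init (φ.fv ∩ ψ.fv) (initState φ ψ).K (by
    rintro x ⟨⟨i, hi, rfl⟩, ⟨j, hj, e⟩⟩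
    have : i = j := Fin.ext (congrArg Prod.fst e)
    subst this
    exact ⟨i, Finset.mem_inter.2 ⟨by simpa using hi, by simpa using hj⟩, rfl⟩)
  obtain ⟨θ, hθ, hs⟩ := h1.toD0 R
  have hmod : ∀ (U : Type) (ρ : Env U Γ) (v : Val U),
      (∀ i : Fin Γ.length, v i.val (Γ.get i) = ρ i) → (initEnv Γ).eval v = ρ := by
    intro U ρ v hv
    funext i
    exact (reflect_eval v _ _).trans (hv i)
  have main : ∀ (U : Type) [Nonempty U] (ρ : Env U Γ),
      (φ.Sat ρ → θ.Sat ρ) ∧ (θ.Sat ρ → ψ.Sat ρ → False) := by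
    intro U _ ρ
    obtain ⟨v, hv⟩ := exists_val ρ
    have hsat := hs U ρ v (hR U ρ v hv)
    have he := hmod U ρ v hv
    refine ⟨fun hφ => hsat.2 (h2 U v ?_), fun hθ' hψ => h3 U v ?_ (hsat.1 hθ')⟩
    · intro f hf
      simp only [initState, List.mem_singleton] at hf
      subst hf
      simpa [Fct.Holds, he] using hφ
    · intro f hf
      simp only [initState, List.mem_singleton] at hf
      subst hf
      simpa [Fct.Holds, he] using hψ
  have hinj : ∀ U : Type, Function.Injective (some : U → Option U) := Option.some_injective
  refine ⟨θ, hθ, fun U ρ hφ => ?_, fun U ρ hθ' hψ => ?_⟩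
  · rw [← D0.sat_map _ (hinj U)] at hφ ⊢
    exact (main (Option U) _).1 hφ
  · rw [← D0.sat_map _ (hinj U)] at hθ' hψ
    exact (main (Option U) _).2 hθ' hψ

/-- **Δ₀ interpolation** (Proposition 4.2): if the conjunction of Δ₀ formulas `φL` and `φR`
entails `ψ` (over all nested relational instances, equivalently over all models), then there
is a Δ₀ interpolant `θ` whose free variables are among the common free variables of `φL`
on the one hand and of `φR` together with `ψ` on the other, such that `φL` entails `θ`
and `θ` together with `φR` entails `ψ`. -/
theorem d0_interpolation {Γ : List NTy} (φL φR ψ : D0 Γ)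
    (h : ∀ (U : Type) (ρ : Env U Γ), φL.Sat ρ → φR.Sat ρ → ψ.Sat ρ) :
    ∃ θ : D0 Γ,
      θ.fv ⊆ φL.fv ∩ (φR.fv ∪ ψ.fv) ∧
      (∀ (U : Type) (ρ : Env U Γ), φL.Sat ρ → θ.Sat ρ) ∧
      (∀ (U : Type) (ρ : Env U Γ), θ.Sat ρ → φR.Sat ρ → ψ.Sat ρ) := by
  obtain ⟨θ, h1, h2, h3⟩ := interp_aux φL (.and φR ψ.neg) (fun U ρ hL hR =>
    (D0.neg_sat ψ ρ).1 hR.2 (h U ρ hL hR.1))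
  refine ⟨θ, ?_, h2, fun U ρ hθ hR => ?_⟩
  · simpa only [D0.fv, D0.neg_fv] using h1
  · by_contra hψ
    exact h3 U ρ hθ ⟨hR, (D0.neg_sat ψ ρ).2 hψ⟩
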